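/- arXiv:2005.08369 — 2 statements merged into one kernel-verified Lean document; each statement's English description precedes it below -/
import Mathlib

section
/- Let J be an open interval with inf J = −∞ or sup J = +∞, α, β ∈ (0,1), α+β=1, and F, G : J → ℝ differentiable with derivatives f, g satisfying [F(b)−F(a)]g(αa+βb) = [G(b)−G(a)]f(αa+βb) for all a, b ∈ J. Suppose U_f ∩ U_g ≠ ∅, and write U_g as a union of mutually disjoint open intervals I_σ. If {1, F, G} are linearly dependent on each I_σ, then {1, F, G} are linearly dependent on all of J. -/
theorem aux_zero {H : ℝ → ℝ} {h a c : ℝ} (hd : HasDerivAt H h a)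
    (hfr : ∀ ε > 0, ∃ z, z ≠ a ∧ |z - a| < ε ∧ H z = c) : h = 0 := by
  by_contra hne
  have h1 := hd.eventually_ne (c := c) hne
  rw [eventually_nhdsWithin_iff, Metric.eventually_nhds_iff] at h1
  obtain ⟨ε, hε, h2⟩ := h1
  obtain ⟨z, hz, hz2, hz3⟩ := hfr ε hε
  exact h2 (by rwa [Real.dist_eq]) hz hz3

theorem aux_const {H h : ℝ → ℝ} {a b : ℝ} (hab : a ≤ b)
    (hd : ∀ x ∈ Set.Icc a b, HasDerivAt H (h x) x) (h0 : ∀ x ∈ Set.Ioo a b, h x = 0) :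
    H b = H a := by
  rcases hab.eq_or_lt with rfl | hlt
  · rfl
  obtain ⟨c, hc, hc2⟩ := exists_hasDerivAt_eq_slope H h hlt
    (fun x hx => (hd x hx).continuousAt.continuousWithinAt)
    (fun x hx => hd x ⟨hx.1.le, hx.2.le⟩)
  rw [h0 c hc, eq_comm, div_eq_zero_iff] at hc2
  rcases hc2 with h | h <;> linarith

/-- points at which `H` is symmetric -/
theorem aux_trans {J : Set ℝ} (hup : ∀ x ∈ J, ∀ y, x ≤ y → y ∈ J)
    {α β : ℝ} (hα : 0 < α) (hβ : 0 < β) (hαβ : α + β = 1) {H h : ℝ → ℝ}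
    (hH : ∀ x ∈ J, HasDerivAt H (h x) x) (m : ℝ)
    (hp : ∀ ε > 0, ∃ x₁ x₂, m ≤ x₁ ∧ x₁ < x₂ ∧ x₂ - x₁ < ε ∧
      (∀ a ∈ J, ∀ b ∈ J, α * a + β * b = x₁ → H b = H a) ∧
      (∀ a ∈ J, ∀ b ∈ J, α * a + β * b = x₂ → H b = H a)) :
    ∀ a ∈ J, a ≤ m → h a = 0 := by
  intro a ha ham
  refine aux_zero (c := H a) (hH a ha) ?_
  intro ε hε
  obtain ⟨x₁, x₂, h1, h2, h3, h4, h5⟩ := hp (α * ε) (by positivity)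
  have hb : a ≤ (x₁ - α * a) / β := by
    rw [le_div_iff₀ hβ]
    have : a * β = a - α * a := by rw [show β = 1 - α by linarith]; ring
    linarith
  have hpos : 0 < (x₂ - x₁) / α := div_pos (by linarith) hα
  have hbJ := hup a ha _ hb
  have haJ := hup a ha (a + (x₂ - x₁) / α) (by linarith)
  refine ⟨a + (x₂ - x₁) / α, by linarith, ?_, ?_⟩
  · rw [add_sub_cancel_left, abs_of_pos hpos, div_lt_iff₀ hα]; linarith
  · rw [← h4 a ha _ hbJ (by field_simp; ring), ← h5 _ haJ _ hbJ (by field_simp; ring)]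

/-- derivative form of the symmetry at x -/
theorem aux_refl {J : Set ℝ} (hJo : IsOpen J) {α β : ℝ} (hα : 0 < α) (hβ : 0 < β)
    {H h : ℝ → ℝ} (hH : ∀ x ∈ J, HasDerivAt H (h x) x) {x : ℝ}
    (hs : ∀ a ∈ J, ∀ b ∈ J, α * a + β * b = x → H b = H a)
    {a b : ℝ} (ha : a ∈ J) (hb : b ∈ J) (hab : α * a + β * b = x) :
    β * h a = - α * h b := by
  have hbeq : b = (x - α * a) / β := by field_simp; linarith
  have e1 : HasDerivAt (fun t => (x - α * t) / β) (-(α * 1) / β) a :=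
    (((hasDerivAt_id a).const_mul α).const_sub x).div_const β
  have e2 : HasDerivAt (fun t => H ((x - α * t) / β)) (h b * (-(α * 1) / β)) a := by
    have := hH b hb
    rw [hbeq] at this
    rw [hbeq]
    exact HasDerivAt.comp a this e1
  have e3 : (fun t => H ((x - α * t) / β)) =ᶠ[nhds a] H := by
    have c1 : ∀ᶠ t in nhds a, (x - α * t) / β ∈ J :=
      e1.continuousAt.eventually (hJo.mem_nhds (by show (x - α * a) / β ∈ J; rw [← hbeq]; exact hb))
    filter_upwards [c1, hJo.mem_nhds ha] with t ht ht2
    exact hs t ht2 _ ht (by field_simp; ring)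
  have e4 := (hH a ha).unique (e2.congr_of_eventuallyEq e3.symm)
  rw [e4]; field_simp

/-- C implies conclusion -/
theorem aux_phase2 {J : Set ℝ} (hJo : IsOpen J) (hup : ∀ x ∈ J, ∀ y, x ≤ y → y ∈ J)
    {α β : ℝ} (hα : 0 < α) (hβ : 0 < β) (hαβ : α + β = 1) {H G h g : ℝ → ℝ}
    (hH : ∀ x ∈ J, HasDerivAt H (h x) x) (hG : ∀ x ∈ J, HasDerivAt G (g x) x)
    (heq : ∀ a ∈ J, ∀ b ∈ J,
      (H b - H a) * g (α * a + β * b) = (G b - G a) * h (α * a + β * b))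
    (x₀ δ : ℝ) (hx₀ : x₀ ∈ J) (hδ : 0 < δ) (hg : g x₀ ≠ 0)
    (hC : ∀ x, x₀ ≤ x → x < x₀ + δ → h x = 0) : ∀ x ∈ J, h x = 0 := by
  have sym0 : ∀ x, g x ≠ 0 → h x = 0 →
      ∀ a ∈ J, ∀ b ∈ J, α * a + β * b = x → H b = H a := by
    intro x h1 h2 a ha b hb hx
    have := heq a ha b hb
    rw [hx, h2, mul_zero] at this
    have := (mul_eq_zero.1 this).resolve_right h1
    linarith
  have hleft : ∀ a ∈ J, a ≤ x₀ → h a = 0 := by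
    refine aux_trans hup hα hβ hαβ hH x₀ ?_
    intro ε hε
    have : ∃ x₂, x₀ < x₂ ∧ x₂ < x₀ + min ε δ ∧ g x₂ ≠ 0 := by
      by_contra hcon
      push Not at hcon
      apply hg
      refine aux_zero (c := G x₀) (hG x₀ hx₀) ?_
      intro η hη
      have hm : 0 < min η (min ε δ) := by positivity
      refine ⟨x₀ + min η (min ε δ) / 2, by linarith, ?_, ?_⟩
      · rw [add_sub_cancel_left, abs_of_pos (by linarith)]
        have := min_le_left η (min ε δ); linarith
      · refine aux_const (h := g) (by linarith) (fun x hx => hG x (hup _ hx₀ _ hx.1)) ?_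
        intro x hx
        apply hcon x hx.1
        have := min_le_right η (min ε δ); linarith [hx.2]
    obtain ⟨x₂, h1, h2, h3⟩ := this
    have m1 := min_le_left ε δ
    have m2 := min_le_right ε δ
    exact ⟨x₀, x₂, le_rfl, h1, by linarith, sym0 _ hg (hC _ le_rfl (by linarith)),
      sym0 _ h3 (hC _ h1.le (by linarith))⟩
  by_contra hcon
  push Not at hcon
  obtain ⟨z, hzJ, hz⟩ := hcon
  set S : Set ℝ := {m | ∀ x ∈ J, x < m → h x = 0} with hS
  have hSb : BddAbove S := ⟨z, fun m hm => by
    by_contra hlt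
    exact hz (hm z hzJ (not_le.1 hlt))⟩
  have hδS : x₀ + δ ∈ S := by
    intro x hx hlt
    rcases le_total x x₀ with h1 | h1
    · exact hleft x hx h1
    · exact hC x h1 hlt
  obtain ⟨M, hM⟩ : ∃ M, M = sSup S := ⟨_, rfl⟩
  have hle : ∀ m ∈ S, m ≤ M := fun m hm => hM ▸ le_csSup hSb hm
  have hMS : M ∈ S := by
    intro x hx hlt
    rw [hM] at hlt
    obtain ⟨m, hm, hxm⟩ := exists_lt_of_lt_csSup ⟨_, hδS⟩ hlt
    exact hm x hx hxm
  have hx₀M : x₀ < M := by linarith [hle _ hδS]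
  have hMJ : M ∈ J := hup _ hx₀ _ hx₀M.le
  -- point to the left of x₀
  obtain ⟨j, hjJ, hj⟩ : ∃ j ∈ J, j < x₀ := by
    obtain ⟨ε, hε, hb⟩ := Metric.isOpen_iff.1 hJo x₀ hx₀
    refine ⟨x₀ - ε / 2, hb ?_, by linarith⟩
    rw [Metric.mem_ball, Real.dist_eq, abs_lt]; constructor <;> linarith
  have hq1 : ∀ x, x₀ ≤ x → x < M → β * M + α * j < x → g x = 0 := by
    intro x hx1 hx2 hx3
    by_contra hgx
    have hxJ := hup _ hx₀ _ hx1
    have hs := sym0 x hgx (hMS x hxJ hx2)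
    have : (x - α * j) / β ∈ S := by
      intro b hb hlt
      rcases lt_or_ge b M with h1 | h1
      · exact hMS b hb h1
      have haj : j < (x - β * b) / α := by
        rw [lt_div_iff₀ hα]; rw [lt_div_iff₀ hβ] at hlt; linarith
      have haM : (x - β * b) / α < M := by
        rw [div_lt_iff₀ hα]
        have := mul_le_mul_of_nonneg_left h1 hβ.le
        have e : M = α * M + β * M := by rw [← add_mul, hαβ, one_mul]
        linarith
      have haJ := hup _ hjJ _ haj.le
      have := aux_refl hJo hα hβ hH hs haJ hb (by field_simp; ring)
      rw [hMS _ haJ haM, mul_zero] at this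
      have h5 : α * h b = 0 := by linarith
      exact (mul_eq_zero.1 h5).resolve_left hα.ne'
    have h6 := hle _ this
    rw [div_le_iff₀ hβ] at h6
    linarith
  obtain ⟨q, hqx, hqM, hgq⟩ : ∃ q, x₀ ≤ q ∧ q < M ∧ ∀ x, q < x → x < M → g x = 0 := by
    refine ⟨max x₀ (β * M + α * j), le_max_left _ _, max_lt hx₀M ?_, ?_⟩
    · have e : M = α * M + β * M := by rw [← add_mul, hαβ, one_mul]
      have := mul_lt_mul_of_pos_left (hj.trans hx₀M) hα
      linarith
    · intro x h1 h2
      exact hq1 x ((le_max_left _ _).trans h1.le) h2 ((le_max_right _ _).trans_lt h1)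
  have hqJ : q ∈ J := hup _ hx₀ _ hqx
  have hhM : h M = 0 := by
    refine aux_zero (c := H M) (hH M hMJ) ?_
    intro ε hε
    have hm : 0 < min ε (M - q) := lt_min hε (by linarith)
    have m1 := min_le_left ε (M - q)
    have m2 := min_le_right ε (M - q)
    refine ⟨M - min ε (M - q) / 2, by linarith, ?_, ?_⟩
    · rw [abs_lt]; constructor <;> linarith
    · refine (aux_const (h := h) (by linarith) (fun x hx => hH x (hup _ hqJ _ ?_)) ?_).symm
      · linarith [hx.1]
      · intro x hx
        exact hMS x (hup _ hqJ _ (by linarith [hx.1])) hx.2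
  have hacc : ∀ ε > 0, ∃ x, M < x ∧ x < M + ε ∧ h x ≠ 0 := by
    intro ε hε
    by_contra hc
    push Not at hc
    have : M + ε ∈ S := by
      intro x hx hlt
      rcases lt_trichotomy x M with h1 | h1 | h1
      · exact hMS x hx h1
      · rw [h1]; exact hhM
      · exact hc x h1 hlt
    linarith [hle _ this]
  -- symmetric function
  have symx : ∀ x, h x ≠ 0 →
      ∀ a ∈ J, ∀ b ∈ J, α * a + β * b = x → G b - g x / h x * H b = G a - g x / h x * H a := by
    intro x h1 a ha b hb hx
    have := heq a ha b hb
    rw [hx] at this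
    field_simp
    linarith
  have hder : ∀ μ : ℝ, ∀ x ∈ J, HasDerivAt (fun t => G t - μ * H t) (g x - μ * h x) x :=
    fun μ x hx => (hG x hx).sub ((hH x hx).const_mul μ)
  have key : ∀ x b, M < x → h x ≠ 0 → M + (x - M) / β < b → b < M + α * (M - q) / β →
      g b = g x / h x * h b := by
    intro x b h1 h2 h3 h4
    have hxM : 0 < (x - M) / β := div_pos (by linarith) hβ
    have hbJ : b ∈ J := hup _ hMJ _ (by linarith)
    have e : M = α * M + β * M := by rw [← add_mul, hαβ, one_mul]
    have h3' : x - M < β * (b - M) := by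
      have : (x - M) / β < b - M := by linarith
      rw [div_lt_iff₀ hβ] at this; linarith
    have h4' : β * (b - M) < α * (M - q) := by
      have : b - M < α * (M - q) / β := by linarith
      rw [lt_div_iff₀ hβ] at this; linarith
    have ha1 : q < (x - β * b) / α := by rw [lt_div_iff₀ hα]; nlinarith
    have ha2 : (x - β * b) / α < M := by rw [div_lt_iff₀ hα]; nlinarith
    have haJ := hup _ hqJ _ ha1.le
    have := aux_refl hJo hα hβ (hder (g x / h x)) (symx x h2) haJ hbJ (by field_simp; ring)
    rw [hgq _ ha1 ha2, hMS _ haJ ha2, mul_zero, sub_zero, mul_zero] at this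
    have h5 : α * (g b - g x / h x * h b) = 0 := by linarith
    have := (mul_eq_zero.1 h5).resolve_left hα.ne'
    linarith
  have hδ' : 0 < α * (M - q) / β := by
    have : 0 < M - q := by linarith
    positivity
  obtain ⟨x₃, h31, h32, h33⟩ := hacc _ hδ'
  obtain ⟨μ, hμ⟩ : ∃ μ, μ = g x₃ / h x₃ := ⟨_, rfl⟩
  have hμeq : ∀ x, M < x → x < M + β * (x₃ - M) → h x ≠ 0 → g x / h x = μ := by
    intro x h1 h2 h3
    have := key x x₃ h1 h3 (by
      have : (x - M) / β < x₃ - M := by rw [div_lt_iff₀ hβ]; linarith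
      linarith) h32
    rw [hμ, this, mul_div_assoc, div_self h33, mul_one]
  have hβx : 0 < β * (x₃ - M) := mul_pos hβ (by linarith)
  have hfin := aux_trans hup hα hβ hαβ (hder μ) M (by
    intro ε hε
    obtain ⟨x₂, a1, a2, a3⟩ := hacc (min ε (β * (x₃ - M))) (lt_min hε hβx)
    obtain ⟨x₁, b1, b2, b3⟩ := hacc (x₂ - M) (by linarith)
    have m1 := min_le_left ε (β * (x₃ - M))
    have m2 := min_le_right ε (β * (x₃ - M))
    refine ⟨x₁, x₂, b1.le, by linarith, by linarith, ?_, ?_⟩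
    · have := symx x₁ b3
      rwa [hμeq x₁ b1 (by linarith) b3] at this
    · have := symx x₂ a3
      rwa [hμeq x₂ a1 (by linarith) a3] at this) x₀ hx₀ hx₀M.le
  rw [hleft x₀ hx₀ le_rfl, mul_zero, sub_zero] at hfin
  exact hg hfin

theorem aux_phase1 {J : Set ℝ} (hJo : IsOpen J) (hup : ∀ x ∈ J, ∀ y, x ≤ y → y ∈ J)
    {α β : ℝ} (hα : 0 < α) (hβ : 0 < β) (hαβ : α + β = 1) {F G f g : ℝ → ℝ}
    (hF : ∀ x ∈ J, HasDerivAt F (f x) x) (hG : ∀ x ∈ J, HasDerivAt G (g x) x)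
    (heq : ∀ a ∈ J, ∀ b ∈ J,
      (F b - F a) * g (α * a + β * b) = (G b - G a) * f (α * a + β * b))
    (hdep : ∀ x y, x < y → (∀ z ∈ Set.Ioo x y, z ∈ J ∧ g z ≠ 0) →
      ∃ l, ∀ z ∈ Set.Ioo x y, f z = l * g z)
    (x₀ : ℝ) (hx₀ : x₀ ∈ J) (hg : g x₀ ≠ 0) :
    ∃ x₁ δ l, x₁ ∈ J ∧ 0 < δ ∧ g x₁ ≠ 0 ∧ ∀ x, x₁ ≤ x → x < x₁ + δ → f x = l * g x := by
  by_contra hC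
  have hC' : ∀ c d l, x₀ ≤ c → c < d → (∀ x ∈ Set.Ioo c d, f x = l * g x) →
      ∀ x ∈ Set.Ioo c d, g x = 0 := by
    intro c d l hc hcd h x hx
    by_contra hgx
    exact hC ⟨x, d - x, l, hup _ hx₀ _ (by linarith [hx.1]), by linarith [hx.2], hgx,
      fun y h1 h2 => h y ⟨by linarith [hx.1], by linarith⟩⟩
  -- a good base point a₀
  have hab : ∀ x : ℝ, (x - α * x) / β = x := by
    intro x
    rw [div_eq_iff hβ.ne', show β = 1 - α by linarith]; ring
  obtain ⟨a₀, ha₀, hb₀, hGne⟩ : ∃ a ∈ J, (x₀ - α * a) / β ∈ J ∧ G ((x₀ - α * a) / β) ≠ G a := by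
    by_contra hc
    push Not at hc
    have := aux_refl hJo hα hβ hG (x := x₀) (a := x₀) (b := x₀) (by
      intro a ha b hb h
      have hbe : b = (x₀ - α * a) / β := by field_simp; linarith
      rw [hbe] at hb ⊢
      exact hc a ha hb) hx₀ hx₀ (by rw [← add_mul, hαβ, one_mul])
    apply hg
    have : (α + β) * g x₀ = 0 := by linarith
    rwa [hαβ, one_mul] at this
  obtain ⟨φ, hφ⟩ : ∃ φ : ℝ → ℝ, φ = fun x => (F ((x - α * a₀) / β) - F a₀) /
    (G ((x - α * a₀) / β) - G a₀) := ⟨_, rfl⟩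
  have hlin : ∀ x, HasDerivAt (fun t : ℝ => (t - α * a₀) / β) (1 / β) x := fun x =>
    ((hasDerivAt_id x).sub_const _).div_const β
  have hV : ∀ᶠ x in nhds x₀, (x - α * a₀) / β ∈ J ∧ G ((x - α * a₀) / β) - G a₀ ≠ 0 := by
    have c1 : ∀ᶠ x in nhds x₀, (x - α * a₀) / β ∈ J :=
      (hlin x₀).continuousAt.eventually (hJo.mem_nhds hb₀)
    have c2 : ContinuousAt (fun x => G ((x - α * a₀) / β) - G a₀) x₀ := by
      refine ContinuousAt.sub ?_ continuousAt_const
      exact ContinuousAt.comp (g := G) (hG _ hb₀).continuousAt (hlin x₀).continuousAt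
    exact c1.and (c2.eventually_ne (sub_ne_zero.2 hGne))
  rw [Metric.eventually_nhds_iff] at hV
  obtain ⟨η, hη, hV⟩ := hV
  have hV' : ∀ x ∈ Set.Ioo x₀ (x₀ + η), (x - α * a₀) / β ∈ J ∧
      G ((x - α * a₀) / β) - G a₀ ≠ 0 := by
    intro x hx
    apply hV
    rw [Real.dist_eq, abs_lt]; constructor <;> linarith [hx.1, hx.2]
  have hWJ : ∀ x, x₀ < x → x ∈ J := fun x hx => hup _ hx₀ _ hx.le
  have hφd : ∀ x ∈ Set.Ioo x₀ (x₀ + η), DifferentiableAt ℝ φ x := by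
    intro x hx
    obtain ⟨h1, h2⟩ := hV' x hx
    rw [hφ]
    have k1 : DifferentiableAt ℝ (fun t => F ((t - α * a₀) / β)) x :=
      DifferentiableAt.comp x (hF _ h1).differentiableAt (hlin x).differentiableAt
    have k2 : DifferentiableAt ℝ (fun t => G ((t - α * a₀) / β)) x :=
      DifferentiableAt.comp x (hG _ h1).differentiableAt (hlin x).differentiableAt
    exact (k1.sub_const _).div (k2.sub_const _) h2
  have hφf : ∀ x ∈ Set.Ioo x₀ (x₀ + η), f x = φ x * g x := by
    intro x hx
    obtain ⟨h1, h2⟩ := hV' x hx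
    have := heq a₀ ha₀ _ h1
    rw [show α * a₀ + β * ((x - α * a₀) / β) = x by field_simp; ring] at this
    rw [hφ]
    simp only
    rw [div_mul_eq_mul_div, this, mul_div_assoc, mul_comm, div_mul_cancel₀ _ h2]
  -- the reflection property
  have hw : ∀ x a b, a ∈ J → b ∈ J → α * a + β * b = x →
      β * (f a * g x - g a * f x) = - α * (f b * g x - g b * f x) := by
    intro x a b ha hb hx
    refine aux_refl hJo hα hβ (H := fun t => F t * g x - G t * f x)
      (h := fun t => f t * g x - g t * f x) (x := x) ?_ ?_ ha hb hx
    · intro y hy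
      exact ((hF y hy).mul_const _).sub ((hG y hy).mul_const _)
    · intro a ha b hb h
      have := heq a ha b hb
      rw [h] at this
      linarith
  have hstep : ∀ y ε, y ∈ J → 0 < ε → f y * g (y + ε) - g y * f (y + ε) ≠ 0 →
      f (y + ε / β) * g (y + ε / β + ε) - g (y + ε / β) * f (y + ε / β + ε) ≠ 0 := by
    intro y ε hy hε hne
    have p1 : 0 < ε / β := by positivity
    have i1 := hup y hy (y + ε) (by linarith)
    have i2 := hup y hy (y + ε / β) (by linarith)
    have i3 := hup y hy (y + ε / β + ε) (by linarith)
    have e1 := hw (y + ε) y (y + ε / β) hy i2 (by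
      rw [show α = 1 - β by linarith]; field_simp; ring)
    have e2 := hw (y + ε / β) (y + ε / β + ε) (y + ε) i3 i1 (by
      rw [show α = 1 - β by linarith]; field_simp; ring)
    intro h0
    apply hne
    have q1 : f (y + ε) * g (y + ε / β) - g (y + ε) * f (y + ε / β) = 0 := by
      have : α * (f (y + ε) * g (y + ε / β) - g (y + ε) * f (y + ε / β)) = 0 := by
        linear_combination e2 + (-1) * (-β) * h0
      exact (mul_eq_zero.1 this).resolve_left hα.ne'
    have : β * (f y * g (y + ε) - g y * f (y + ε)) = 0 := by
      linear_combination e1 + α * q1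
    exact (mul_eq_zero.1 this).resolve_left hβ.ne'
  have hchain : ∀ ε, 0 < ε → f x₀ * g (x₀ + ε) - g x₀ * f (x₀ + ε) ≠ 0 → ∀ n : ℕ,
      f (x₀ + n * (ε / β)) * g (x₀ + n * (ε / β) + ε)
        - g (x₀ + n * (ε / β)) * f (x₀ + n * (ε / β) + ε) ≠ 0 := by
    intro ε hε h0 n
    induction n with
    | zero => simpa using h0
    | succ n ih =>
      have := hstep _ ε (hup _ hx₀ _ (by
        have : 0 ≤ (n : ℝ) * (ε / β) := by positivity
        linarith)) hε ih
      rw [show x₀ + ((n + 1 : ℕ) : ℝ) * (ε / β) = x₀ + n * (ε / β) + ε / β by push_cast; ring]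
      exact this
  have hdense : ∀ c d, x₀ < c → c < d → ∃ y ∈ Set.Ioo c d, f y ≠ 0 ∨ g y ≠ 0 := by
    intro c d hc hcd
    obtain ⟨ε, hε, hεd, hne⟩ : ∃ ε, 0 < ε ∧ ε < β * (d - c) ∧
        f x₀ * g (x₀ + ε) - g x₀ * f (x₀ + ε) ≠ 0 := by
      by_contra hcon
      push Not at hcon
      refine hC ⟨x₀, β * (d - c), f x₀ / g x₀, hx₀, mul_pos hβ (by linarith), hg, ?_⟩
      intro x h1 h2
      rcases h1.eq_or_lt with rfl | h1
      · field_simp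
      · have := hcon (x - x₀) (by linarith) (by linarith)
        rw [add_sub_cancel] at this
        field_simp
        linarith
    have hτ : 0 < ε / β := by positivity
    have hτd : ε / β < d - c := by rw [div_lt_iff₀ hβ]; linarith
    obtain ⟨n, hn⟩ : ∃ n : ℕ, n = ⌊(c - x₀) / (ε / β)⌋₊ := ⟨_, rfl⟩
    have n1 : (n : ℝ) * (ε / β) ≤ c - x₀ := by
      rw [← le_div_iff₀ hτ, hn]
      exact Nat.floor_le (div_nonneg (by linarith) hτ.le)
    have n2 : c - x₀ < ((n : ℝ) + 1) * (ε / β) := by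
      rw [← div_lt_iff₀ hτ, hn]
      exact Nat.lt_floor_add_one _
    refine ⟨x₀ + ((n + 1 : ℕ) : ℝ) * (ε / β), ⟨?_, ?_⟩, ?_⟩
    · push_cast; linarith
    · push_cast; linarith
    · have := hchain ε hε hne (n + 1)
      by_contra hcon
      push Not at hcon
      rw [hcon.1, hcon.2] at this
      simp at this
  have hdg : ∀ c d, x₀ < c → c < d → d ≤ x₀ + η → ∃ y ∈ Set.Ioo c d, g y ≠ 0 := by
    intro c d h1 h2 h3
    obtain ⟨y, hy, hy2⟩ := hdense c d h1 h2
    refine ⟨y, hy, ?_⟩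
    intro h0
    have := hφf y ⟨by linarith [hy.1], by linarith [hy.2]⟩
    rw [h0, mul_zero] at this
    rcases hy2 with h | h
    · exact h this
    · exact h h0
  -- no constancy
  have hnoc : ∀ c d l, x₀ ≤ c → c < d → d ≤ x₀ + η → ¬ ∀ x ∈ Set.Ioo c d, f x = l * g x := by
    intro c d l h1 h2 h3 h
    obtain ⟨y, hy, hy2⟩ := hdg ((c + d) / 2) d (by linarith) (by linarith) h3
    exact hy2 (hC' c d l h1 h2 h y ⟨by linarith [hy.1], hy.2⟩)
  -- the equation with φ
  have hφe : ∀ x ∈ Set.Ioo x₀ (x₀ + η), ∀ a ∈ J, ∀ b ∈ J, α * a + β * b = x →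
      F b - F a = φ x * (G b - G a) := by
    intro x hx a ha b hb hab
    by_contra hne
    have hc : ContinuousAt (fun t => (F (b + (t - x)) - F (a + (t - x))) -
        φ t * (G (b + (t - x)) - G (a + (t - x)))) x := by
      have s : ∀ e : ℝ, ContinuousAt (fun t : ℝ => e + (t - x)) x := fun e => by fun_prop
      have s1 : ∀ P : ℝ → ℝ, ∀ e, ContinuousAt P e →
          ContinuousAt (fun t : ℝ => P (e + (t - x))) x := fun P e hP =>
        ContinuousAt.comp (g := P) (by simpa using hP) (s e)
      exact ((s1 F b (hF b hb).continuousAt).sub (s1 F a (hF a ha).continuousAt)).sub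
        ((hφd x hx).continuousAt.mul
          ((s1 G b (hG b hb).continuousAt).sub (s1 G a (hG a ha).continuousAt)))
    have h1 := hc.eventually_ne (y := 0) (by simpa using sub_ne_zero.2 hne)
    rw [Metric.eventually_nhds_iff] at h1
    obtain ⟨ε, hε, h1⟩ := h1
    have hm : 0 < min ε (x₀ + η - x) := lt_min hε (by linarith [hx.2])
    have m1 := min_le_left ε (x₀ + η - x)
    have m2 := min_le_right ε (x₀ + η - x)
    obtain ⟨y, hy, hy2⟩ := hdg x (x + min ε (x₀ + η - x)) hx.1 (by linarith) (by linarith)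
    refine h1 (y := y) (by rw [Real.dist_eq, abs_lt]; constructor <;> linarith [hy.1, hy.2]) ?_
    have h2 := heq (a + (y - x)) (hup a ha _ (by linarith [hy.1])) (b + (y - x))
      (hup b hb _ (by linarith [hy.1]))
    rw [show α * (a + (y - x)) + β * (b + (y - x)) = y by
      linear_combination hab + (y - x) * hαβ,
      hφf y ⟨by linarith [hx.1, hy.1], by linarith [hy.2]⟩] at h2
    apply mul_right_cancel₀ hy2
    linear_combination h2
  have hφder : ∀ x ∈ Set.Ioo x₀ (x₀ + η), ∀ a ∈ J, ∀ b ∈ J, α * a + β * b = x →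
      f b = β * deriv φ x * (G b - G a) + φ x * g b := by
    intro x hx a ha b hb hab
    have d1 : HasDerivAt (fun t => α * a + β * t) (β * 1) b :=
      ((hasDerivAt_id b).const_mul β).const_add _
    have d2 : HasDerivAt (fun t => φ (α * a + β * t)) (deriv φ x * (β * 1)) b := by
      have := (hφd x hx).hasDerivAt
      rw [← hab] at this ⊢
      exact HasDerivAt.comp b this d1
    have d3 := d2.mul ((hG b hb).sub_const (G a))
    have d4 := (hF b hb).sub_const (F a)
    have hev : (fun t => F t - F a) =ᶠ[nhds b]
        ((fun t => φ (α * a + β * t)) * (fun t => G t - G a)) := by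
      have c1 : ∀ᶠ t in nhds b, α * a + β * t ∈ Set.Ioo x₀ (x₀ + η) :=
        d1.continuousAt.eventually (isOpen_Ioo.mem_nhds (by
          show α * a + β * b ∈ _
          rw [hab]; exact hx))
      filter_upwards [c1, hJo.mem_nhds hb] with t ht ht2
      exact hφe _ ht a ha t ht2 rfl
    have := d4.unique (d3.congr_of_eventuallyEq hev)
    rw [this, hab]; ring
  obtain ⟨x₁, hx₁, hφ'⟩ : ∃ x ∈ Set.Ioo x₀ (x₀ + η), deriv φ x ≠ 0 := by
    by_contra hcon
    push Not at hcon
    refine hnoc (x₀ + η / 2) (x₀ + η) (φ (x₀ + η / 2)) (by linarith) (by linarith) le_rfl ?_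
    intro x hx
    rw [hφf x ⟨by linarith [hx.1], hx.2⟩]
    rw [aux_const (H := φ) (h := deriv φ) hx.1.le]
    · intro y hy
      exact (hφd y ⟨by linarith [hy.1], by linarith [hy.2, hx.2]⟩).hasDerivAt
    · intro y hy
      exact hcon y ⟨by linarith [hy.1], by linarith [hy.2, hx.2]⟩
  have hx₁J := hWJ x₁ hx₁.1
  have hRc : Continuous (fun b : ℝ => (x₁ - β * b) / α) := by fun_prop
  have hR : ∀ᶠ b in nhds x₁, (x₁ - β * b) / α ∈ J := by
    refine hRc.continuousAt.eventually (hJo.mem_nhds ?_)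
    show (x₁ - β * x₁) / α ∈ J
    rw [show (x₁ - β * x₁) / α = x₁ by
      rw [div_eq_iff hα.ne', show α = 1 - β by linarith]; ring]
    exact hx₁J
  rw [Metric.eventually_nhds_iff] at hR
  obtain ⟨r, hr, hR⟩ := hR
  have hm : 0 < min r (x₀ + η - x₁) := lt_min hr (by linarith [hx₁.2])
  have m1 := min_le_left r (x₀ + η - x₁)
  have m2 := min_le_right r (x₀ + η - x₁)
  obtain ⟨d, hd⟩ : ∃ d, d = x₁ + min r (x₀ + η - x₁) := ⟨_, rfl⟩
  have hform : ∀ b ∈ Set.Ioo x₁ d, (φ b - φ x₁) * g b =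
      β * deriv φ x₁ * (G b - G ((x₁ - β * b) / α)) := by
    intro b hb
    have := hφder x₁ hx₁ ((x₁ - β * b) / α)
      (hR (by rw [Real.dist_eq, abs_lt]; constructor <;> linarith [hb.1, hb.2])) b
      (hup _ hx₁J _ hb.1.le) (by field_simp; ring)
    rw [hφf b ⟨by linarith [hb.1, hx₁.1], by linarith [hb.2]⟩] at this
    linear_combination this
  obtain ⟨b, hb, hbne⟩ : ∃ b ∈ Set.Ioo x₁ d, (φ b - φ x₁) * g b ≠ 0 := by
    by_contra hcon
    push Not at hcon
    refine hnoc x₁ d (φ x₁) hx₁.1.le (by linarith) (by linarith) ?_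
    intro x hx
    rw [hφf x ⟨by linarith [hx.1, hx₁.1], by linarith [hx.2]⟩]
    linear_combination hcon x hx
  have hcont : ContinuousAt (fun b => β * deriv φ x₁ * (G b - G ((x₁ - β * b) / α))) b := by
    refine continuousAt_const.mul ((hG b (hup _ hx₁J _ hb.1.le)).continuousAt.sub ?_)
    refine ContinuousAt.comp (g := G) ?_ hRc.continuousAt
    exact (hG _ (hR (by rw [Real.dist_eq, abs_lt]; constructor <;>
      linarith [hb.1, hb.2]))).continuousAt
  have hev := (hcont.eventually_ne (y := 0) (by rw [← hform b hb]; exact hbne)).and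
    (isOpen_Ioo.mem_nhds hb)
  rw [Metric.eventually_nhds_iff] at hev
  obtain ⟨s, hs, hev⟩ := hev
  have hI : ∀ z ∈ Set.Ioo (b - s) (b + s), z ∈ Set.Ioo x₁ d ∧ g z ≠ 0 := by
    intro z hz
    obtain ⟨h1, h2⟩ := hev (y := z) (by
      rw [Real.dist_eq, abs_lt]; constructor <;> linarith [hz.1, hz.2])
    refine ⟨h2, fun h0 => h1 ?_⟩
    rw [← hform z h2, h0, mul_zero]
  obtain ⟨l, hl⟩ := hdep (b - s) (b + s) (by linarith)
    (fun z hz => ⟨hup _ hx₁J _ (hI z hz).1.1.le, (hI z hz).2⟩)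
  exact hnoc b ((b + min (b + s) d) / 2) l (by linarith [hb.1, hx₁.1])
    (by
      have : b < min (b + s) d := lt_min (by linarith) hb.2
      linarith)
    (by
      have := min_le_right (b + s) d
      linarith [hb.2])
    (fun x hx => hl x ⟨by linarith [hx.1], by
      have := min_le_left (b + s) d
      linarith [hx.2]⟩)

theorem aux_main {J : Set ℝ} (hJo : IsOpen J) (hup : ∀ x ∈ J, ∀ y, x ≤ y → y ∈ J)
    {α β : ℝ} (hα : 0 < α) (hβ : 0 < β) (hαβ : α + β = 1) {F G f g : ℝ → ℝ}
    (hF : ∀ x ∈ J, HasDerivAt F (f x) x) (hG : ∀ x ∈ J, HasDerivAt G (g x) x)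
    (heq : ∀ a ∈ J, ∀ b ∈ J,
      (F b - F a) * g (α * a + β * b) = (G b - G a) * f (α * a + β * b))
    (hdep : ∀ x y, x < y → (∀ z ∈ Set.Ioo x y, z ∈ J ∧ g z ≠ 0) →
      ∃ l, ∀ z ∈ Set.Ioo x y, f z = l * g z)
    (x₀ : ℝ) (hx₀ : x₀ ∈ J) (hg : g x₀ ≠ 0) :
    ∃ l c, ∀ x ∈ J, F x = l * G x + c := by
  obtain ⟨x₁, δ, l, h1, h2, h3, h4⟩ :=
    aux_phase1 hJo hup hα hβ hαβ hF hG heq hdep x₀ hx₀ hg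
  have hd : ∀ x ∈ J, HasDerivAt (fun t => F t - l * G t) (f x - l * g x) x :=
    fun x hx => (hF x hx).sub ((hG x hx).const_mul l)
  have := aux_phase2 hJo hup hα hβ hαβ (H := fun t => F t - l * G t)
    (h := fun t => f t - l * g t) hd hG
    (by
      intro a ha b hb
      linear_combination heq a ha b hb) x₁ δ h1 h2 h3
    (fun x k1 k2 => by rw [h4 x k1 k2, sub_self])
  refine ⟨l, F x₀ - l * G x₀, fun x hx => ?_⟩
  rcases le_total x₀ x with k | k
  · have := aux_const k (fun y hy => hd y (hup _ hx₀ _ hy.1))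
      (fun y hy => this y (hup _ hx₀ _ hy.1.le))
    linarith
  · have := aux_const k (fun y hy => hd y (hup _ hx _ hy.1))
      (fun y hy => this y (hup _ hx _ hy.1.le))
    linarith

/-- Proposition 3.3 -/
theorem stmt_8 (J : Set ℝ) (hJo : IsOpen J) (hJc : J.OrdConnected) (hJne : J.Nonempty)
    (hJinf : ¬ BddBelow J ∨ ¬ BddAbove J)
    (α β : ℝ) (hα : α ∈ Set.Ioo (0:ℝ) 1) (hβ : β ∈ Set.Ioo (0:ℝ) 1) (hαβ : α + β = 1)
    (F G f g : ℝ → ℝ)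
    (hF : ∀ x ∈ J, HasDerivAt F (f x) x) (hG : ∀ x ∈ J, HasDerivAt G (g x) x)
    (heq : ∀ a ∈ J, ∀ b ∈ J,
      (F b - F a) * g (α * a + β * b) = (G b - G a) * f (α * a + β * b))
    (hmeet : ({x ∈ J | f x ≠ 0} ∩ {x ∈ J | g x ≠ 0}).Nonempty)
    (hdep : ∀ x ∈ {x ∈ J | g x ≠ 0},
      ∃ c₁ c₂ c₃ : ℝ, (c₁, c₂, c₃) ≠ (0, 0, 0) ∧
        ∀ y ∈ connectedComponentIn {x ∈ J | g x ≠ 0} x,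
          c₁ * F y + c₂ * G y + c₃ = 0) :
    ∃ c₁ c₂ c₃ : ℝ, (c₁, c₂, c₃) ≠ (0, 0, 0) ∧
      ∀ x ∈ J, c₁ * F x + c₂ * G x + c₃ = 0 := by
  have hdep' : ∀ x y, x < y → (∀ z ∈ Set.Ioo x y, z ∈ J ∧ g z ≠ 0) →
      ∃ l, ∀ z ∈ Set.Ioo x y, f z = l * g z := by
    intro x y hxy hz
    have hm : (x + y) / 2 ∈ Set.Ioo x y := ⟨by linarith, by linarith⟩
    obtain ⟨c₁, c₂, c₃, hc, h⟩ := hdep _ (hz _ hm)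
    have hsub : Set.Ioo x y ⊆ connectedComponentIn {x ∈ J | g x ≠ 0} ((x + y) / 2) :=
      isPreconnected_Ioo.subset_connectedComponentIn hm (fun z h => hz z h)
    have hder : ∀ z ∈ Set.Ioo x y, c₁ * f z + c₂ * g z = 0 := by
      intro z hzz
      have d := (((hF z (hz z hzz).1).const_mul c₁).add
        ((hG z (hz z hzz).1).const_mul c₂)).add_const c₃
      refine d.unique ((hasDerivAt_const z (0 : ℝ)).congr_of_eventuallyEq ?_)
      filter_upwards [isOpen_Ioo.mem_nhds hzz] with t ht
      exact h t (hsub ht)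
    have hc1 : c₁ ≠ 0 := by
      rintro rfl
      have e := hder _ hm
      rw [zero_mul, zero_add] at e
      have e2 := (mul_eq_zero.1 e).resolve_right (hz _ hm).2
      have e3 := h _ (hsub hm)
      rw [e2, zero_mul, zero_mul, zero_add, zero_add] at e3
      exact hc (by rw [e2, e3])
    refine ⟨- c₂ / c₁, fun z hzz => ?_⟩
    have := hder z hzz
    field_simp
    linarith
  obtain ⟨x₀, ⟨hx₀, -⟩, -, hg⟩ := hmeet
  suffices hs : ∃ l c, ∀ x ∈ J, F x = l * G x + c by
    obtain ⟨l, c, h⟩ := hs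
    refine ⟨1, -l, -c, by simp, fun x hx => ?_⟩
    rw [h x hx]; ring
  rcases hJinf with hb | hb
  · -- reflect
    have hdown : ∀ x ∈ J, ∀ y, y ≤ x → y ∈ J := by
      intro x hx y hy
      rw [not_bddBelow_iff] at hb
      obtain ⟨z, hz, hzy⟩ := hb y
      exact hJc.out hz hx ⟨hzy.le, hy⟩
    have hneg : ∀ P p : ℝ → ℝ, (∀ x ∈ J, HasDerivAt P (p x) x) →
        ∀ x ∈ (fun t : ℝ => -t) ⁻¹' J, HasDerivAt (fun t => P (-t)) (- p (-x)) x := by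
      intro P p hP x hx
      have := HasDerivAt.comp x (hP (-x) hx) (hasDerivAt_neg x)
      rw [mul_neg_one] at this
      exact this
    obtain ⟨l, c, h⟩ := aux_main (J := (fun t : ℝ => -t) ⁻¹' J) (hJo.preimage continuous_neg)
      (fun x hx y hy => hdown (-x) hx (-y) (by linarith)) hα.1 hβ.1 hαβ
      (hneg F f hF) (hneg G g hG)
      (by
        intro a ha b hb
        have := heq (-a) ha (-b) hb
        rw [show α * -a + β * -b = -(α * a + β * b) by ring] at this
        linear_combination -this)
      (by
        intro x y hxy hz
        obtain ⟨l, hl⟩ := hdep' (-y) (-x) (by linarith) (by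
          intro z hzz
          have := hz (-z) ⟨by linarith [hzz.2], by linarith [hzz.1]⟩
          simpa using this)
        refine ⟨l, fun z hzz => ?_⟩
        rw [hl (-z) ⟨by linarith [hzz.2], by linarith [hzz.1]⟩]
        ring) (-x₀) (by simpa using hx₀) (by simpa using hg)
    refine ⟨l, c, fun x hx => ?_⟩
    have := h (-x) (by simpa using hx)
    simpa using this
  · have hup : ∀ x ∈ J, ∀ y, x ≤ y → y ∈ J := by
      intro x hx y hy
      rw [not_bddAbove_iff] at hb
      obtain ⟨z, hz, hzy⟩ := hb y
      exact hJc.out hx hz ⟨hy, hzy.le⟩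
    exact aux_main hJo hup hα.1 hβ.1 hαβ hF hG heq hdep' x₀ hx₀ hg
end

section
/- Let J be an open interval with inf J = −∞ or sup J = +∞, and F, G : J → ℝ differentiable with derivatives f, g satisfying [F(b)−F(a)]g((a+b)/2) = [G(b)−G(a)]f((a+b)/2) for all a, b ∈ J. Then one of the following holds: (a) {1, F, G} are linearly dependent on J; (b) F, G ∈ span{1, x, x²} on J; (c) there exists μ ≠ 0 with F, G ∈ span{1, e^{μx}, e^{−μx}} on J; (d) there exists μ ≠ 0 with F, G ∈ span{1, sin(μx), cos(μx)} on J. -/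
open Filter Topology

theorem sc_cast {P : ℝ → ℝ} {d d' x : ℝ} (h : HasDerivAt P d x) (e : d' = d) :
    HasDerivAt P d' x := e ▸ h

theorem sc_const (J : Set ℝ) (hJo : IsOpen J) (hJc : J.OrdConnected) (P : ℝ → ℝ)
    (h : ∀ x ∈ J, HasDerivAt P 0 x) : ∃ c, ∀ x ∈ J, P x = c := by
  have hp : IsPreconnected J := hJc.isPreconnected
  rcases J.eq_empty_or_nonempty with h0 | ⟨x0, hx0⟩
  · exact ⟨0, by simp [h0]⟩
  refine ⟨P x0, fun x hx => ?_⟩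
  exact hJo.is_const_of_deriv_eq_zero hp
    (fun y hy => (h y hy).differentiableAt.differentiableWithinAt)
    (fun y hy => (h y hy).deriv) hx hx0

/-- differentiated equation -/
theorem sc_star (J : Set ℝ) (hJo : IsOpen J) 
    (F G f g : ℝ → ℝ)
    (hF : ∀ x ∈ J, HasDerivAt F (f x) x) (hG : ∀ x ∈ J, HasDerivAt G (g x) x)
    (heq : ∀ a ∈ J, ∀ b ∈ J,
      (F b - F a) * g ((a + b) / 2) = (G b - G a) * f ((a + b) / 2))
    (m h : ℝ) (h1 : m + h ∈ J) (h2 : m - h ∈ J) :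
    (f (m+h) + f (m-h)) * g m = (g (m+h) + g (m-h)) * f m := by
  have dp : HasDerivAt (fun t : ℝ => m + t) 1 h := by simpa using (hasDerivAt_id h).const_add m
  have dm : HasDerivAt (fun t : ℝ => m - t) (-1) h := by simpa using (hasDerivAt_id h).const_sub m
  have A := (((hF _ h1).comp h dp).sub ((hF _ h2).comp h dm)).mul_const (g m)
  have B := (((hG _ h1).comp h dp).sub ((hG _ h2).comp h dm)).mul_const (f m)
  have e1 : ∀ᶠ t in 𝓝 h, m + t ∈ J := dp.continuousAt.eventually_mem (hJo.mem_nhds h1)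
  have e2 : ∀ᶠ t in 𝓝 h, m - t ∈ J := dm.continuousAt.eventually_mem (hJo.mem_nhds h2)
  have C := B.congr_of_eventuallyEq (f₁ := fun t => (F (m + t) - F (m - t)) * g m) (by
    filter_upwards [e1, e2] with t t1 t2
    have := heq _ t2 _ t1
    rw [show (m - t + (m + t))/2 = m by ring] at this
    simpa using this)
  have := A.unique C
  linarith

theorem sc_acc1 (J : Set ℝ) (hJo : IsOpen J) (F f : ℝ → ℝ)
    (hF : ∀ x ∈ J, HasDerivAt F (f x) x) (m : ℝ) (hm : m ∈ J) (hfm : f m ≠ 0) :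
    ∃ᶠ x in 𝓝[≠] m, f x ≠ 0 := by
  intro hc
  simp only [not_not] at hc
  have hne : ∀ᶠ z in 𝓝[≠] m, F z ≠ F m := (hF m hm).eventually_ne hfm
  have hJe : ∀ᶠ z in 𝓝[≠] m, z ∈ J := nhdsWithin_le_nhds (hJo.mem_nhds hm)
  have hall := hc.and (hne.and hJe)
  rw [eventually_nhdsWithin_iff, Metric.eventually_nhds_iff] at hall
  obtain ⟨ε, hε, H⟩ := hall
  have hJ' : ∀ y, dist y m < ε → y ∈ J := by
    intro y hy
    by_cases h : y = m
    · rw [h]; exact hm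
    · exact (H hy h).2.2
  have hb : m < m + ε/2 := by linarith
  obtain ⟨c, hcI, hc2⟩ := exists_hasDerivAt_eq_slope F f hb
    (fun y hy => (hF y (hJ' y (by
      rw [Real.dist_eq, abs_lt]; constructor <;> linarith [hy.1, hy.2]))).continuousAt.continuousWithinAt)
    (fun y hy => hF y (hJ' y (by
      rw [Real.dist_eq, abs_lt]; constructor <;> linarith [hy.1, hy.2])))
  have := (H (y := c) (by rw [Real.dist_eq, abs_lt]; constructor <;> linarith [hcI.1, hcI.2]) (ne_of_gt hcI.1)).1
  rw [this] at hc2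
  have h3 := (H (y := m + ε/2) (by rw [Real.dist_eq, abs_lt]; constructor <;> linarith) (ne_of_gt hb)).2.1
  have h4 : m + ε/2 - m ≠ 0 := by linarith
  rw [eq_comm, div_eq_zero_iff] at hc2
  rcases hc2 with h5 | h5
  · exact h3 (by linarith)
  · exact h4 h5

theorem sc_key (J : Set ℝ) (hJo : IsOpen J)
    (F G f g : ℝ → ℝ)
    (hF : ∀ x ∈ J, HasDerivAt F (f x) x) (hG : ∀ x ∈ J, HasDerivAt G (g x) x)
    (heq : ∀ a ∈ J, ∀ b ∈ J,
      (F b - F a) * g ((a + b) / 2) = (G b - G a) * f ((a + b) / 2))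
    (m : ℝ) (hm : m ∈ J) :
    ∃ p q : ℝ, ∀ h, m + h ∈ J → m - h ∈ J →
      f (m+h) * g m - g (m+h) * f m = p * (F (m+h) - F (m-h)) + q * (G (m+h) - G (m-h)) := by
  by_cases hN : f m = 0 ∧ g m = 0
  · exact ⟨0, 0, fun h _ _ => by simp [hN.1, hN.2]⟩
  have hs : f m ^ 2 + g m ^ 2 ≠ 0 := by
    intro h
    exact hN ⟨by nlinarith [sq_nonneg (f m), sq_nonneg (g m)], by nlinarith [sq_nonneg (f m), sq_nonneg (g m)]⟩
  have hacc : ∃ᶠ x in 𝓝[≠] m, ¬ (f x = 0 ∧ g x = 0) := by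
    by_cases h : f m = 0
    · have : g m ≠ 0 := fun h' => hN ⟨h, h'⟩
      exact (sc_acc1 J hJo G g hG m hm this).mono fun x hx hh => hx hh.2
    · exact (sc_acc1 J hJo F f hF m hm h).mono fun x hx hh => hx hh.1
  -- equation in midpoint form
  have hmid : ∀ x h, x + h ∈ J → x - h ∈ J →
      (F (x+h) - F (x-h)) * g x = (G (x+h) - G (x-h)) * f x := by
    intro x h h1 h2
    have := heq _ h2 _ h1
    rwa [show (x - h + (x + h))/2 = x by ring] at this
  -- scalar representation
  have hα : ∀ h, m + h ∈ J → m - h ∈ J → ∃ α, F (m+h) - F (m-h) = α * f m ∧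
      G (m+h) - G (m-h) = α * g m := by
    intro h h1 h2
    have := hmid m h h1 h2
    refine ⟨((F (m+h) - F (m-h)) * f m + (G (m+h) - G (m-h)) * g m)/(f m^2+g m^2), ?_, ?_⟩
    · field_simp; linear_combination (g m) * this
    · field_simp; linear_combination (-f m) * this
  -- nonzero k
  obtain ⟨k, hk1, hk2, hk⟩ : ∃ k, m + k ∈ J ∧ m - k ∈ J ∧
      ¬ (F (m+k) - F (m-k) = 0 ∧ G (m+k) - G (m-k) = 0) := by
    have dp : HasDerivAt (fun t : ℝ => m + t) 1 0 := by simpa using (hasDerivAt_id (0:ℝ)).const_add m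
    have dm : HasDerivAt (fun t : ℝ => m - t) (-1) 0 := by simpa using (hasDerivAt_id (0:ℝ)).const_sub m
    have m1 : m + 0 ∈ J := by simpa using hm
    have m2 : m - 0 ∈ J := by simpa using hm
    have A := ((hF _ m1).comp 0 dp).sub ((hF _ m2).comp 0 dm)
    have B := ((hG _ m1).comp 0 dp).sub ((hG _ m2).comp 0 dm)
    have e1 : ∀ᶠ t in 𝓝[≠] (0:ℝ), m + t ∈ J := nhdsWithin_le_nhds (dp.continuousAt.eventually_mem (hJo.mem_nhds m1))
    have e2 : ∀ᶠ t in 𝓝[≠] (0:ℝ), m - t ∈ J := nhdsWithin_le_nhds (dm.continuousAt.eventually_mem (hJo.mem_nhds m2))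
    by_cases h : f m = 0
    · have hg : g m ≠ 0 := fun h' => hN ⟨h, h'⟩
      have := B.eventually_ne (c := 0) (by simp only [add_zero, sub_zero]; intro h; apply hg; linarith)
      obtain ⟨k, a, b, c⟩ := (e1.and (e2.and this)).exists
      exact ⟨k, a, b, fun hh => c hh.2⟩
    · have := A.eventually_ne (c := 0) (by simp only [add_zero, sub_zero]; intro h'; apply h; linarith)
      obtain ⟨k, a, b, c⟩ := (e1.and (e2.and this)).exists
      exact ⟨k, a, b, fun hh => c hh.1⟩
  obtain ⟨β, hβ1, hβ2⟩ := hα k hk1 hk2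
  have hβ : β ≠ 0 := by
    rintro rfl; exact hk ⟨by simpa using hβ1, by simpa using hβ2⟩
  have star := fun h a b => sc_star J hJo F G f g hF hG heq m h a b
  set κ := (f (m+k) * g m - g (m+k) * f m) / β with hκ
  refine ⟨κ * f m / (f m ^2 + g m^2), κ * g m / (f m ^2 + g m^2), fun h h1 h2 => ?_⟩
  obtain ⟨α, hα1, hα2⟩ := hα h h1 h2
  have hmain : (f (m+h) * g m - g (m+h) * f m) * β = (f (m+k) * g m - g (m+k) * f m) * α := by
    have dp : ∀ t : ℝ, HasDerivAt (fun x : ℝ => x + t) 1 m := fun t => by simpa using (hasDerivAt_id m).add_const t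
    have dm : ∀ t : ℝ, HasDerivAt (fun x : ℝ => x - t) 1 m := fun t => by simpa using (hasDerivAt_id m).sub_const t
    have AF := fun t a b => ((hF (m+t) a).comp m (dp t)).sub ((hF (m-t) b).comp m (dm t))
    have AG := fun t a b => ((hG (m+t) a).comp m (dp t)).sub ((hG (m-t) b).comp m (dm t))
    have Φ := ((AF h h1 h2).mul (AG k hk1 hk2)).sub ((AG h h1 h2).mul (AF k hk1 hk2))
    have e1 : ∀ t, m + t ∈ J → ∀ᶠ x in 𝓝[≠] m, x + t ∈ J := fun t ht =>
      nhdsWithin_le_nhds ((dp t).continuousAt.eventually_mem (hJo.mem_nhds ht))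
    have e2 : ∀ t, m - t ∈ J → ∀ᶠ x in 𝓝[≠] m, x - t ∈ J := fun t ht =>
      nhdsWithin_le_nhds ((dm t).continuousAt.eventually_mem (hJo.mem_nhds ht))
    have hz : (f (m + h) * 1 - f (m - h) * 1) * (G (m+k) - G (m-k)) + (F (m+h) - F (m-h)) * (g (m+k) * 1 - g (m-k) * 1)
        - ((g (m + h) * 1 - g (m - h) * 1) * (F (m+k) - F (m-k)) + (G (m+h) - G (m-h)) * (f (m+k) * 1 - f (m-k) * 1)) = 0 := by
      by_contra hne
      have ev := Φ.eventually_ne (c := 0) hne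
      obtain ⟨x, x0, x1, x2, x3, x4, x5⟩ := (hacc.and_eventually ((e1 h h1).and ((e2 h h2).and ((e1 k hk1).and ((e2 k hk2).and ev))))).exists
      apply x5
      have a := hmid x h x1 x2
      have b := hmid x k x3 x4
      simp only [Pi.sub_apply, Pi.mul_apply, Function.comp_apply]
      by_cases hf : f x = 0
      · have hg : g x ≠ 0 := fun h' => x0 ⟨hf, h'⟩
        apply mul_right_cancel₀ hg
        linear_combination (G (x+k) - G (x-k)) * a - (G (x+h) - G (x-h)) * b
      · apply mul_right_cancel₀ hf
        linear_combination (F (x+k) - F (x-k)) * a - (F (x+h) - F (x-h)) * b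
    rw [hβ1, hβ2, hα1, hα2] at hz
    have s1 := star h h1 h2
    have s2 := star k hk1 hk2
    linear_combination (1/2) * hz + β/2 * s1 - α / 2 * s2
  have : f (m+h) * g m - g (m+h) * f m = κ * α := by
    rw [hκ]; field_simp; linarith
  rw [this, hα1, hα2]
  field_simp

theorem sc_step (J : Set ℝ) (hJo : IsOpen J)
    (F G f g : ℝ → ℝ)
    (hup : ∀ x ∈ J, ∀ y, x ≤ y → y ∈ J)
    (hF : ∀ x ∈ J, HasDerivAt F (f x) x) (hG : ∀ x ∈ J, HasDerivAt G (g x) x)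
    (heq : ∀ a ∈ J, ∀ b ∈ J,
      (F b - F a) * g ((a + b) / 2) = (G b - G a) * f ((a + b) / 2))
    (hlarge : ∀ M, ∃ m₁ ∈ J, ∃ m₂ ∈ J, M < m₁ ∧ M < m₂ ∧ f m₁ * g m₂ - g m₁ * f m₂ ≠ 0)
    (n : ℕ) (hFn : ∀ y ∈ J, ContDiffAt ℝ n F y) (hGn : ∀ y ∈ J, ContDiffAt ℝ n G y)
    (y : ℝ) (hy : y ∈ J) : ContDiffAt ℝ n f y ∧ ContDiffAt ℝ n g y := by
  obtain ⟨m₁, h1, m₂, h2, hM1, hM2, hD⟩ := hlarge y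
  have key : ∀ m ∈ J, y < m → ∃ D : ℝ → ℝ, ContDiffAt ℝ n D y ∧
      ∀ᶠ z in 𝓝 y, f z * g m - g z * f m = D z := by
    intro m hm hym
    obtain ⟨p, q, hpq⟩ := sc_key J hJo F G f g hF hG heq m hm
    refine ⟨fun z => p * (F z - F (2 * m - z)) + q * (G z - G (2*m - z)), ?_, ?_⟩
    · have hy' : 2 * m - y ∈ J := hup y hy _ (by linarith)
      have hl : ContDiffAt ℝ n (fun z : ℝ => 2 * m - z) y := by fun_prop
      have a1 : ContDiffAt ℝ n (fun z : ℝ => F (2 * m - z)) y := (hFn _ hy').comp y hl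
      have a2 : ContDiffAt ℝ n (fun z : ℝ => G (2 * m - z)) y := (hGn _ hy').comp y hl
      exact (contDiffAt_const.mul ((hFn y hy).sub a1)).add (contDiffAt_const.mul ((hGn y hy).sub a2))
    · filter_upwards [hJo.mem_nhds hy, Iio_mem_nhds hym] with z hz hzm
      have := hpq (z - m) (by simpa using hz) (hup z hz _ (by have : z < m := hzm; linarith))
      rw [show m + (z - m) = z by ring, show m - (z - m) = 2 * m - z by ring] at this
      exact this
  obtain ⟨D₁, c1, e1⟩ := key m₁ h1 hM1
  obtain ⟨D₂, c2, e2⟩ := key m₂ h2 hM2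
  constructor
  · have : ContDiffAt ℝ n (fun z => (f m₁ * D₂ z - f m₂ * D₁ z) / (f m₁ * g m₂ - g m₁ * f m₂)) y :=
      ((contDiffAt_const.mul c2).sub (contDiffAt_const.mul c1)).div_const _
    refine this.congr_of_eventuallyEq ?_
    filter_upwards [e1, e2] with z z1 z2
    rw [← z1, ← z2, eq_div_iff hD]; ring
  · have : ContDiffAt ℝ n (fun z => (g m₁ * D₂ z - g m₂ * D₁ z) / (f m₁ * g m₂ - g m₁ * f m₂)) y :=
      ((contDiffAt_const.mul c2).sub (contDiffAt_const.mul c1)).div_const _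
    refine this.congr_of_eventuallyEq ?_
    filter_upwards [e1, e2] with z z1 z2
    rw [← z1, ← z2, eq_div_iff hD]; ring

theorem sc_succ (J : Set ℝ) (hJo : IsOpen J) (F f : ℝ → ℝ)
    (hF : ∀ x ∈ J, HasDerivAt F (f x) x) (n : ℕ)
    (hf : ∀ y ∈ J, ContDiffAt ℝ n f y) : ∀ y ∈ J, ContDiffAt ℝ (n+1 : ℕ) F y := by
  have : ContDiffOn ℝ ((n:WithTop ℕ∞) + 1) F J := by
    rw [contDiffOn_succ_iff_deriv_of_isOpen hJo]
    refine ⟨fun x hx => (hF x hx).differentiableAt.differentiableWithinAt, by simp, ?_⟩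
    refine ContDiffOn.congr (f := f) (fun x hx => (hf x hx).contDiffWithinAt) (fun x hx => (hF x hx).deriv)
  intro y hy
  exact_mod_cast this.contDiffAt (hJo.mem_nhds hy)

theorem sc_smooth (J : Set ℝ) (hJo : IsOpen J)
    (F G f g : ℝ → ℝ)
    (hup : ∀ x ∈ J, ∀ y, x ≤ y → y ∈ J)
    (hF : ∀ x ∈ J, HasDerivAt F (f x) x) (hG : ∀ x ∈ J, HasDerivAt G (g x) x)
    (heq : ∀ a ∈ J, ∀ b ∈ J,
      (F b - F a) * g ((a + b) / 2) = (G b - G a) * f ((a + b) / 2))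
    (hlarge : ∀ M, ∃ m₁ ∈ J, ∃ m₂ ∈ J, M < m₁ ∧ M < m₂ ∧ f m₁ * g m₂ - g m₁ * f m₂ ≠ 0)
    (n : ℕ) : ∀ y ∈ J, ContDiffAt ℝ n F y ∧ ContDiffAt ℝ n G y := by
  induction n with
  | zero =>
    have c : ∀ (F f : ℝ → ℝ), (∀ x ∈ J, HasDerivAt F (f x) x) → ∀ y ∈ J, ContDiffAt ℝ (0:ℕ) F y := by
      intro F f hF y hy
      have : ContDiffOn ℝ 0 F J := contDiffOn_zero.2 fun x hx => (hF x hx).continuousAt.continuousWithinAt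
      exact_mod_cast this.contDiffAt (hJo.mem_nhds hy)
    exact fun y hy => ⟨c F f hF y hy, c G g hG y hy⟩
  | succ n ih =>
    have st := sc_step J hJo F G f g hup hF hG heq hlarge n (fun y hy => (ih y hy).1) (fun y hy => (ih y hy).2)
    exact fun y hy => ⟨sc_succ J hJo F f hF n (fun z hz => (st z hz).1) y hy,
      sc_succ J hJo G g hG n (fun z hz => (st z hz).2) y hy⟩

theorem sc_derivs (J : Set ℝ) (hJo : IsOpen J) (f : ℝ → ℝ) (h : ∀ y ∈ J, ContDiffAt ℝ (3:ℕ) f y) :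
    ∃ f1 f2 f3 : ℝ → ℝ, (∀ x ∈ J, HasDerivAt f (f1 x) x) ∧ (∀ x ∈ J, HasDerivAt f1 (f2 x) x) ∧
      (∀ x ∈ J, HasDerivAt f2 (f3 x) x) := by
  have h3 : ContDiffOn ℝ (2+1) f J := fun x hx => by
    have := (h x hx).contDiffWithinAt (s := J)
    norm_num at this ⊢; exact this
  rw [contDiffOn_succ_iff_deriv_of_isOpen hJo] at h3
  obtain ⟨d0, -, h2⟩ := h3
  rw [show (2:WithTop ℕ∞) = 1 + 1 by norm_num, contDiffOn_succ_iff_deriv_of_isOpen hJo] at h2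
  obtain ⟨d1, -, h1⟩ := h2
  have d2 := h1.differentiableOn (by norm_num)
  exact ⟨_, _, _, fun x hx => (d0.differentiableAt (hJo.mem_nhds hx)).hasDerivAt,
    fun x hx => (d1.differentiableAt (hJo.mem_nhds hx)).hasDerivAt,
    fun x hx => (d2.differentiableAt (hJo.mem_nhds hx)).hasDerivAt⟩

/-- nondegenerate points propagate to infinity -/
theorem sc_large (J : Set ℝ) (f g : ℝ → ℝ)
    (hup : ∀ x ∈ J, ∀ y, x ≤ y → y ∈ J)
    (star : ∀ m h, m + h ∈ J → m - h ∈ J → 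
      (f (m+h) + f (m-h)) * g m = (g (m+h) + g (m-h)) * f m)
    (a b : ℝ) (ha : a ∈ J) (hb : b ∈ J) (hD : f a * g b - g a * f b ≠ 0) :
    ∀ M, ∃ m₁ ∈ J, ∃ m₂ ∈ J, M < m₁ ∧ M < m₂ ∧ f m₁ * g m₂ - g m₁ * f m₂ ≠ 0 := by
  wlog hab : a < b generalizing a b
  · have hne : a ≠ b := by rintro rfl; apply hD; ring
    exact this b a hb ha (fun h => hD (by linarith)) (lt_of_le_of_ne (not_lt.1 hab) hne.symm)
  have hpos : 0 < b - a := by linarith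
  have hmem : ∀ n : ℕ, a + n * (b - a) ∈ J := fun n => hup a ha _ (by
    have : (0:ℝ) ≤ n * (b - a) := by positivity
    linarith)
  have ind : ∀ n : ℕ, f (a + n * (b-a)) * g (a + (n+1 : ℕ) * (b-a)) - g (a + n * (b-a)) * f (a + (n+1 : ℕ) * (b-a)) ≠ 0 := by
    intro n
    induction n with
    | zero => simpa using hD
    | succ n ih =>
      have h1 := hmem (n+1+1)
      have h2 := hmem n
      have := star (a + (n+1:ℕ) * (b-a)) (b-a) (by convert h1 using 1; push_cast; ring)
        (by convert h2 using 1; push_cast; ring)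
      rw [show a + ((n+1:ℕ):ℝ) * (b-a) + (b - a) = a + ((n+1+1:ℕ):ℝ) * (b-a) by push_cast; ring,
        show a + ((n+1:ℕ):ℝ) * (b-a) - (b - a) = a + (n:ℝ) * (b-a) by push_cast; ring] at this
      intro h
      apply ih
      linear_combination h + this
  intro M
  obtain ⟨n, hn⟩ := exists_nat_gt ((M - a)/(b-a))
  rw [div_lt_iff₀ hpos] at hn
  refine ⟨_, hmem n, _, hmem (n+1), by linarith, by push_cast; linarith, ind n⟩

/-- ODE: v'' = lam v -/
theorem sc_ode (J : Set ℝ) (hJo : IsOpen J) (hJc : J.OrdConnected)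
    (F G f g f1 g1 f2 g2 f3 g3 : ℝ → ℝ)
    (hup : ∀ x ∈ J, ∀ y, x ≤ y → y ∈ J)
    (hF : ∀ x ∈ J, HasDerivAt F (f x) x) (hG : ∀ x ∈ J, HasDerivAt G (g x) x)
    (hf : ∀ x ∈ J, HasDerivAt f (f1 x) x) (hg : ∀ x ∈ J, HasDerivAt g (g1 x) x)
    (hf1 : ∀ x ∈ J, HasDerivAt f1 (f2 x) x) (hg1 : ∀ x ∈ J, HasDerivAt g1 (g2 x) x)
    (hf2 : ∀ x ∈ J, HasDerivAt f2 (f3 x) x) (hg2 : ∀ x ∈ J, HasDerivAt g2 (g3 x) x)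
    (heq : ∀ a ∈ J, ∀ b ∈ J,
      (F b - F a) * g ((a + b) / 2) = (G b - G a) * f ((a + b) / 2))
    (a b : ℝ) (ha : a ∈ J) (hb : b ∈ J) (hD : f a * g b - g a * f b ≠ 0) :
    ∃ lam : ℝ, ∀ x ∈ J, f2 x = lam * f x ∧ g2 x = lam * g x := by
  have star := sc_star J hJo F G f g hF hG heq
  -- second derivative in h
  have dstar : ∀ (u v u' v' : ℝ → ℝ) (s : ℝ) (α β : ℝ), (∀ x ∈ J, HasDerivAt u (u' x) x) →
      (∀ x ∈ J, HasDerivAt v (v' x) x) → ∀ m, 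
      (∀ h, m + h ∈ J → m - h ∈ J → (u (m+h) + s * u (m-h)) * α = (v (m+h) + s * v (m-h)) * β) →
      (∀ h, m + h ∈ J → m - h ∈ J → (u' (m+h) + (-s) * u' (m-h)) * α = (v' (m+h) + (-s) * v' (m-h)) * β) := by
    intro u v u' v' s α β hu hv m H h h1 h2
    have dp : HasDerivAt (fun t : ℝ => m + t) 1 h := by simpa using (hasDerivAt_id h).const_add m
    have dm : HasDerivAt (fun t : ℝ => m - t) (-1) h := by simpa using (hasDerivAt_id h).const_sub m
    have A := (((hu _ h1).comp h dp).add (((hu _ h2).comp h dm).const_mul s)).mul_const α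
    have B := (((hv _ h1).comp h dp).add (((hv _ h2).comp h dm).const_mul s)).mul_const β
    have e1 : ∀ᶠ t in 𝓝 h, m + t ∈ J := dp.continuousAt.eventually_mem (hJo.mem_nhds h1)
    have e2 : ∀ᶠ t in 𝓝 h, m - t ∈ J := dm.continuousAt.eventually_mem (hJo.mem_nhds h2)
    have C := B.congr_of_eventuallyEq (f₁ := fun t => (u (m + t) + s * u (m - t)) * α) (by
      filter_upwards [e1, e2] with t t1 t2
      simpa using H t t1 t2)
    have := A.unique C
    linarith
  have star2 : ∀ m h, m + h ∈ J → m - h ∈ J → 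
      (f2 (m+h) + f2 (m-h)) * g m = (g2 (m+h) + g2 (m-h)) * f m := by
    intro m h h1 h2
    have s1 := dstar f g f1 g1 1 (g m) (f m) hf hg m (by simpa using star m)
    have s2 := dstar f1 g1 f2 g2 (-1) (g m) (f m) hf1 hg1 m s1 h h1 h2
    simpa using s2
  have par : ∀ m ∈ J, f2 m * g m = g2 m * f m := by
    intro m hm
    have := star2 m 0 (by simpa using hm) (by simpa using hm)
    simp only [add_zero, sub_zero] at this
    linarith
  obtain ⟨w, hw⟩ := sc_const J hJo hJc (fun x => f1 x * g x - g1 x * f x) (fun x hx => by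
    have := ((hf1 x hx).mul (hg x hx)).sub ((hg1 x hx).mul (hf x hx))
    have hp := par x hx
    rw [show f2 x * g x + f1 x * g1 x - (g2 x * f x + g1 x * f1 x) = 0 by linarith] at this
    exact this)
  have hw0 : w ≠ 0 := by
    wlog hab : a < b generalizing a b
    · have hne : a ≠ b := by rintro rfl; apply hD; ring
      exact this b a hb ha (fun h => hD (by linarith)) (lt_of_le_of_ne (not_lt.1 hab) hne.symm)
    intro hw0
    obtain ⟨p, q, hpq⟩ := sc_key J hJo F G f g hF hG heq b hb
    have dp : HasDerivAt (fun t : ℝ => b + t) 1 0 := by simpa using (hasDerivAt_id (0:ℝ)).const_add b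
    have dm : HasDerivAt (fun t : ℝ => b - t) (-1) 0 := by simpa using (hasDerivAt_id (0:ℝ)).const_sub b
    have m1 : b + 0 ∈ J := by simpa using hb
    have m2 : b - 0 ∈ J := by simpa using hb
    have A := ((((hF _ m1).comp 0 dp).sub ((hF _ m2).comp 0 dm)).const_mul p).add 
      ((((hG _ m1).comp 0 dp).sub ((hG _ m2).comp 0 dm)).const_mul q)
    have B := (((hf _ m1).comp 0 dp).mul_const (g b)).sub (((hg _ m1).comp 0 dp).mul_const (f b))
    have e1 : ∀ᶠ t in 𝓝 (0:ℝ), b + t ∈ J := dp.continuousAt.eventually_mem (hJo.mem_nhds m1)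
    have e2 : ∀ᶠ t in 𝓝 (0:ℝ), b - t ∈ J := dm.continuousAt.eventually_mem (hJo.mem_nhds m2)
    have C := A.congr_of_eventuallyEq (f₁ := fun t => f (b + t) * g b - g (b + t) * f b) (by
      filter_upwards [e1, e2] with t t1 t2
      simpa using hpq t t1 t2)
    have hu := B.unique C
    simp only [add_zero, sub_zero] at hu
    have hwb := hw b hb
    have hpq0 : p * f b + q * g b = 0 := by linarith
    have i1 : b + (a - b) ∈ J := by simpa using ha
    have i2 : b - (a - b) ∈ J := hup b hb _ (by linarith)
    have k1 := hpq (a - b) i1 i2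
    have k2 := heq _ i2 _ i1
    rw [show (b - (a - b) + (b + (a - b)))/2 = b by ring] at k2
    apply hD
    rw [show b + (a - b) = a by ring] at k1 k2
    have hfg : f b ≠ 0 ∨ g b ≠ 0 := by
      by_contra! hh
      apply hD; rw [hh.1, hh.2]; ring
    rw [k1]
    rcases hfg with hh | hh
    · apply mul_right_cancel₀ hh
      linear_combination (F a - F (b - (a-b))) * hpq0 - q * k2
    · apply mul_right_cancel₀ hh
      linear_combination (G a - G (b - (a-b))) * hpq0 + p * k2
  -- lam
  have hlam : ∀ x ∈ J, f2 x = (f1 x * g2 x - g1 x * f2 x) / w * f x ∧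
      g2 x = (f1 x * g2 x - g1 x * f2 x) / w * g x := by
    intro x hx
    have h1 := par x hx
    have h2 := hw x hx
    constructor
    · field_simp
      linear_combination (-f2 x) * h2 + f1 x * h1
    · field_simp
      linear_combination (-g2 x) * h2 + g1 x * h1
  set L : ℝ → ℝ := fun x => (f1 x * g2 x - g1 x * f2 x) / w with hL
  have hlamL : ∀ x ∈ J, f2 x = L x * f x ∧ g2 x = L x * g x := hlam
  have hLd : ∀ x ∈ J, ∃ l, HasDerivAt L l x := fun x hx =>
    ⟨_, (((hf1 x hx).mul (hg2 x hx)).sub ((hg1 x hx).mul (hf2 x hx))).div_const w⟩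
  have hL0 : ∀ m ∈ J, HasDerivAt L 0 m := by
    intro m hm
    obtain ⟨l, hl⟩ := hLd m hm
    have dp : HasDerivAt (fun t : ℝ => m + t) 1 0 := by simpa using (hasDerivAt_id (0:ℝ)).const_add m
    have dm : HasDerivAt (fun t : ℝ => m - t) (-1) 0 := by simpa using (hasDerivAt_id (0:ℝ)).const_sub m
    have m1 : m + 0 ∈ J := by simpa using hm
    have m2 : m - 0 ∈ J := by simpa using hm
    have e1 : ∀ᶠ t in 𝓝[≠] (0:ℝ), m + t ∈ J := nhdsWithin_le_nhds (dp.continuousAt.eventually_mem (hJo.mem_nhds m1))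
    have e2 : ∀ᶠ t in 𝓝[≠] (0:ℝ), m - t ∈ J := nhdsWithin_le_nhds (dm.continuousAt.eventually_mem (hJo.mem_nhds m2))
    have B := (((hf _ m1).comp 0 dp).mul_const (g m)).sub (((hg _ m1).comp 0 dp).mul_const (f m))
    have hwm := hw m hm
    have ev := B.eventually_ne (c := 0) (by simp only [add_zero, mul_one]; rw [hwm]; exact hw0)
    have A := (HasDerivAt.comp 0 (by simpa using hl : HasDerivAt L l (m + 0)) dp).sub
      (HasDerivAt.comp 0 (by simpa using hl : HasDerivAt L l (m - 0)) dm)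
    have l0 : l = 0 := by
      by_contra hl0
      have ev2 := A.eventually_ne (c := 0) (by intro h; apply hl0; linarith)
      obtain ⟨t, t1, t2, t3, t4⟩ := (e1.and (e2.and (ev.and ev2))).exists
      simp only [Pi.sub_apply, Function.comp_apply] at t3 t4
      have s := star m t t1 t2
      have s2 := star2 m t t1 t2
      rw [(hlamL _ t1).1, (hlamL _ t2).1, (hlamL _ t1).2, (hlamL _ t2).2] at s2
      apply t4
      apply mul_right_cancel₀ t3
      linear_combination s2 - L (m - t) * s
    rwa [l0] at hl
  obtain ⟨lam, hlamc⟩ := sc_const J hJo hJc L hL0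
  refine ⟨lam, fun x hx => ?_⟩
  have := hlam x hx
  rw [← hlamc x hx]
  exact this

theorem sc_solve0 (J : Set ℝ) (hJo : IsOpen J) (hJc : J.OrdConnected) (F f f1 : ℝ → ℝ)
    (hF : ∀ x ∈ J, HasDerivAt F (f x) x) (hf : ∀ x ∈ J, HasDerivAt f (f1 x) x)
    (hf1 : ∀ x ∈ J, HasDerivAt f1 0 x) :
    ∃ a b c : ℝ, ∀ x ∈ J, F x = a + b * x + c * x^2 := by
  obtain ⟨c, hc⟩ := sc_const J hJo hJc f1 hf1
  obtain ⟨b, hb⟩ := sc_const J hJo hJc (fun x => f x - c * x) (fun x hx => by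
    have := (hf x hx).sub ((hasDerivAt_id x).const_mul c)
    rw [hc x hx, mul_one, sub_self] at this
    exact this)
  obtain ⟨a, ha⟩ := sc_const J hJo hJc (fun x => F x - (b * x + c / 2 * x ^ 2)) (fun x hx => by
    have := (hF x hx).sub (((hasDerivAt_id x).const_mul b).add (((hasDerivAt_pow 2 x)).const_mul (c/2)))
    have h2 : f x - c * x = b := hb x hx
    refine sc_cast this ?_
    push_cast; simp; linarith)
  refine ⟨a, b, c/2, fun x hx => ?_⟩
  have : F x - (b * x + c / 2 * x ^ 2) = a := ha x hx
  linarith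

theorem sc_solve_shift (J : Set ℝ) (hJo : IsOpen J) (hJc : J.OrdConnected) (F f f1 : ℝ → ℝ) (l : ℝ)
    (hl : l ≠ 0)
    (hF : ∀ x ∈ J, HasDerivAt F (f x) x) 
    (hf1 : ∀ x ∈ J, HasDerivAt f1 (l * f x) x) :
    ∃ c : ℝ, ∀ x ∈ J, f1 x = l * (F x - c) := by
  obtain ⟨c, hc⟩ := sc_const J hJo hJc (fun x => f1 x - l * F x) (fun x hx => by
    have := (hf1 x hx).sub ((hF x hx).const_mul l)
    rw [sub_self] at this
    exact this)
  refine ⟨-c / l, fun x hx => ?_⟩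
  have : f1 x - l * F x = c := hc x hx
  field_simp; linarith

theorem sc_solve_pos (J : Set ℝ) (hJo : IsOpen J) (hJc : J.OrdConnected) (F f f1 : ℝ → ℝ) (μ : ℝ)
    (hμ : μ ≠ 0)
    (hF : ∀ x ∈ J, HasDerivAt F (f x) x) (hf : ∀ x ∈ J, HasDerivAt f (f1 x) x)
    (hf1 : ∀ x ∈ J, HasDerivAt f1 (μ ^ 2 * f x) x) :
    ∃ a b c : ℝ, ∀ x ∈ J, F x = a + b * Real.exp (μ * x) + c * Real.exp (-(μ * x)) := by
  obtain ⟨a, ha⟩ := sc_solve_shift J hJo hJc F f f1 (μ^2) (by positivity) hF hf1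
  have de : ∀ x, HasDerivAt (fun x => Real.exp (μ * x)) (Real.exp (μ * x) * μ) x := fun x => by
    simpa using ((hasDerivAt_id x).const_mul μ).exp
  have dn : ∀ x, HasDerivAt (fun x => Real.exp (-(μ * x))) (Real.exp (-(μ * x)) * (-μ)) x := fun x => by
    simpa using ((hasDerivAt_id x).const_mul μ).neg.exp
  obtain ⟨A, hA⟩ := sc_const J hJo hJc (fun x => (f x + μ * (F x - a)) * Real.exp (-(μ * x))) (fun x hx => by
    have := ((hf x hx).add (((hF x hx).sub_const a).const_mul μ)).mul (dn x)
    refine sc_cast this ?_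
    simp only [Pi.add_apply]
    rw [ha x hx]; ring)
  obtain ⟨B, hB⟩ := sc_const J hJo hJc (fun x => (f x - μ * (F x - a)) * Real.exp (μ * x)) (fun x hx => by
    have := ((hf x hx).sub (((hF x hx).sub_const a).const_mul μ)).mul (de x)
    refine sc_cast this ?_
    simp only [Pi.sub_apply]
    rw [ha x hx]; ring)
  refine ⟨a, A / (2 * μ), - B / (2 * μ), fun x hx => ?_⟩
  have h1 : (f x + μ * (F x - a)) * Real.exp (-(μ * x)) = A := hA x hx
  have h2 : (f x - μ * (F x - a)) * Real.exp (μ * x) = B := hB x hx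
  have h3 : Real.exp (-(μ * x)) * Real.exp (μ * x) = 1 := by rw [← Real.exp_add]; simp
  rw [← h1, ← h2]
  field_simp
  linear_combination (-2 * μ * (F x - a)) * h3

theorem sc_solve_neg (J : Set ℝ) (hJo : IsOpen J) (hJc : J.OrdConnected) (F f f1 : ℝ → ℝ) (μ : ℝ)
    (hμ : μ ≠ 0)
    (hF : ∀ x ∈ J, HasDerivAt F (f x) x) (hf : ∀ x ∈ J, HasDerivAt f (f1 x) x)
    (hf1 : ∀ x ∈ J, HasDerivAt f1 (-μ ^ 2 * f x) x) :
    ∃ a b c : ℝ, ∀ x ∈ J, F x = a + b * Real.sin (μ * x) + c * Real.cos (μ * x) := by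
  obtain ⟨a, ha⟩ := sc_solve_shift J hJo hJc F f f1 (-μ^2) (by simpa using hμ) hF hf1
  have ds : ∀ x, HasDerivAt (fun x => Real.sin (μ * x)) (Real.cos (μ * x) * μ) x := fun x => by
    simpa using ((hasDerivAt_id x).const_mul μ).sin
  have dc : ∀ x, HasDerivAt (fun x => Real.cos (μ * x)) (-Real.sin (μ * x) * μ) x := fun x => by
    simpa using ((hasDerivAt_id x).const_mul μ).cos
  obtain ⟨A, hA⟩ := sc_const J hJo hJc (fun x => μ * (F x - a) * Real.sin (μ * x) + f x * Real.cos (μ * x)) (fun x hx => by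
    have := ((((hF x hx).sub_const a).const_mul μ).mul (ds x)).add ((hf x hx).mul (dc x))
    refine sc_cast this ?_
    rw [ha x hx]; ring)
  obtain ⟨B, hB⟩ := sc_const J hJo hJc (fun x => μ * (F x - a) * Real.cos (μ * x) - f x * Real.sin (μ * x)) (fun x hx => by
    have := ((((hF x hx).sub_const a).const_mul μ).mul (dc x)).sub ((hf x hx).mul (ds x))
    refine sc_cast this ?_
    rw [ha x hx]; ring)
  refine ⟨a, A / μ, B / μ, fun x hx => ?_⟩
  have h1 : μ * (F x - a) * Real.sin (μ * x) + f x * Real.cos (μ * x) = A := hA x hx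
  have h2 : μ * (F x - a) * Real.cos (μ * x) - f x * Real.sin (μ * x) = B := hB x hx
  have h3 := Real.sin_sq_add_cos_sq (μ * x)
  rw [← h1, ← h2]
  field_simp
  linear_combination (-μ * (F x - a)) * h3

theorem sc_up (J : Set ℝ) (hJo : IsOpen J) (hJc : J.OrdConnected)
    (hJinf : ¬ BddAbove J)
    (F G f g : ℝ → ℝ)
    (hF : ∀ x ∈ J, HasDerivAt F (f x) x) (hG : ∀ x ∈ J, HasDerivAt G (g x) x)
    (heq : ∀ a ∈ J, ∀ b ∈ J,
      (F b - F a) * g ((a + b) / 2) = (G b - G a) * f ((a + b) / 2)) :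
    (∃ c₁ c₂ c₃ : ℝ, (c₁, c₂, c₃) ≠ (0, 0, 0) ∧
        ∀ x ∈ J, c₁ * F x + c₂ * G x + c₃ = 0) ∨
    ((∃ a b c : ℝ, ∀ x ∈ J, F x = a + b * x + c * x^2) ∧
     (∃ a b c : ℝ, ∀ x ∈ J, G x = a + b * x + c * x^2)) ∨
    (∃ μ : ℝ, μ ≠ 0 ∧
      (∃ a b c : ℝ, ∀ x ∈ J,
        F x = a + b * Real.exp (μ * x) + c * Real.exp (-(μ * x))) ∧
      (∃ a b c : ℝ, ∀ x ∈ J,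
        G x = a + b * Real.exp (μ * x) + c * Real.exp (-(μ * x)))) ∨
    (∃ μ : ℝ, μ ≠ 0 ∧
      (∃ a b c : ℝ, ∀ x ∈ J,
        F x = a + b * Real.sin (μ * x) + c * Real.cos (μ * x)) ∧
      (∃ a b c : ℝ, ∀ x ∈ J,
        G x = a + b * Real.sin (μ * x) + c * Real.cos (μ * x))) := by
  have hup : ∀ x ∈ J, ∀ y, x ≤ y → y ∈ J := by
    intro x hx y hxy
    obtain ⟨z, hz, hyz⟩ := not_bddAbove_iff.1 hJinf y
    exact hJc.out hx hz ⟨hxy, hyz.le⟩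
  by_cases hdeg : ∀ a ∈ J, ∀ b ∈ J, f a * g b - g a * f b = 0
  · left
    by_cases hz : ∀ x ∈ J, f x = 0
    · obtain ⟨c, hc⟩ := sc_const J hJo hJc F (fun x hx => by simpa [hz x hx] using hF x hx)
      exact ⟨1, 0, -c, by simp, fun x hx => by rw [hc x hx]; ring⟩
    · push Not at hz
      obtain ⟨b, hb, hfb⟩ := hz
      obtain ⟨c, hc⟩ := sc_const J hJo hJc (fun x => g b * F x - f b * G x) (fun x hx => by
        have := ((hF x hx).const_mul (g b)).sub ((hG x hx).const_mul (f b))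
        have h := hdeg x hx b hb
        rw [show g b * f x - f b * g x = 0 by linarith] at this
        exact this)
      refine ⟨g b, -f b, -c, by simp [hfb], fun x hx => ?_⟩
      have : g b * F x - f b * G x = c := hc x hx
      linarith
  right
  push Not at hdeg
  obtain ⟨a, ha, b, hb, hD⟩ := hdeg
  have hlarge := sc_large J f g hup (sc_star J hJo F G f g hF hG heq) a b ha hb hD
  have sm := sc_smooth J hJo F G f g hup hF hG heq hlarge 3
  have st := sc_step J hJo F G f g hup hF hG heq hlarge 3 (fun y hy => (sm y hy).1) (fun y hy => (sm y hy).2)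
  obtain ⟨f1, f2, f3, hf, hf1, hf2⟩ := sc_derivs J hJo f (fun y hy => (st y hy).1)
  obtain ⟨g1, g2, g3, hg, hg1, hg2⟩ := sc_derivs J hJo g (fun y hy => (st y hy).2)
  obtain ⟨l, hl⟩ := sc_ode J hJo hJc F G f g f1 g1 f2 g2 f3 g3 hup hF hG hf hg hf1 hg1 hf2 hg2 heq a b ha hb hD
  have hf1' : ∀ x ∈ J, HasDerivAt f1 (l * f x) x := fun x hx => by
    rw [← (hl x hx).1]; exact hf1 x hx
  have hg1' : ∀ x ∈ J, HasDerivAt g1 (l * g x) x := fun x hx => by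
    rw [← (hl x hx).2]; exact hg1 x hx
  rcases lt_trichotomy l 0 with h | h | h
  · right; right
    have hs : l = -(√(-l)) ^ 2 := by rw [Real.sq_sqrt (by linarith)]; ring
    have h0 : √(-l) ≠ 0 := (Real.sqrt_pos.2 (by linarith)).ne'
    generalize √(-l) = μ at hs h0
    subst hs
    exact ⟨μ, h0, sc_solve_neg J hJo hJc F f f1 μ h0 hF hf hf1', sc_solve_neg J hJo hJc G g g1 μ h0 hG hg hg1'⟩
  · left
    subst h
    simp only [zero_mul] at hf1' hg1'
    exact ⟨sc_solve0 J hJo hJc F f f1 hF hf hf1', sc_solve0 J hJo hJc G g g1 hG hg hg1'⟩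
  · right; left
    have hs : l = (√l) ^ 2 := by rw [Real.sq_sqrt (by linarith)]
    have h0 : √l ≠ 0 := (Real.sqrt_pos.2 (by linarith)).ne'
    generalize √l = μ at hs h0
    subst hs
    exact ⟨μ, h0, sc_solve_pos J hJo hJc F f f1 μ h0 hF hf hf1', sc_solve_pos J hJo hJc G g g1 μ h0 hG hg hg1'⟩

/-- Main result, symmetric case, semi-infinite interval. -/
theorem stmt_19 (J : Set ℝ) (hJo : IsOpen J) (hJc : J.OrdConnected) (hJne : J.Nonempty)
    (hJinf : ¬ BddBelow J ∨ ¬ BddAbove J)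
    (F G f g : ℝ → ℝ)
    (hF : ∀ x ∈ J, HasDerivAt F (f x) x) (hG : ∀ x ∈ J, HasDerivAt G (g x) x)
    (heq : ∀ a ∈ J, ∀ b ∈ J,
      (F b - F a) * g ((a + b) / 2) = (G b - G a) * f ((a + b) / 2)) :
    (∃ c₁ c₂ c₃ : ℝ, (c₁, c₂, c₃) ≠ (0, 0, 0) ∧
        ∀ x ∈ J, c₁ * F x + c₂ * G x + c₃ = 0) ∨
    ((∃ a b c : ℝ, ∀ x ∈ J, F x = a + b * x + c * x^2) ∧
     (∃ a b c : ℝ, ∀ x ∈ J, G x = a + b * x + c * x^2)) ∨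
    (∃ μ : ℝ, μ ≠ 0 ∧
      (∃ a b c : ℝ, ∀ x ∈ J,
        F x = a + b * Real.exp (μ * x) + c * Real.exp (-(μ * x))) ∧
      (∃ a b c : ℝ, ∀ x ∈ J,
        G x = a + b * Real.exp (μ * x) + c * Real.exp (-(μ * x)))) ∨
    (∃ μ : ℝ, μ ≠ 0 ∧
      (∃ a b c : ℝ, ∀ x ∈ J,
        F x = a + b * Real.sin (μ * x) + c * Real.cos (μ * x)) ∧
      (∃ a b c : ℝ, ∀ x ∈ J,
        G x = a + b * Real.sin (μ * x) + c * Real.cos (μ * x))) := by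
  rcases hJinf with hb | hb
  swap
  · exact sc_up J hJo hJc hb F G f g hF hG heq
  have hmem : ∀ x, x ∈ J → - x ∈ (-J : Set ℝ) := fun x hx => by simpa using hx
  have dn : ∀ x : ℝ, HasDerivAt (fun t : ℝ => -t) (-1) x := fun x => hasDerivAt_neg x
  have R := sc_up (-J) hJo.neg
    ⟨fun x hx y hy z hz => hJc.out hy hx ⟨by linarith [hz.2], by linarith [hz.1]⟩⟩
    (by rwa [bddAbove_neg])
    (fun x => F (-x)) (fun x => G (-x)) (fun x => - f (-x)) (fun x => - g (-x))
    (fun x hx => sc_cast ((hF (-x) hx).comp x (dn x)) (by ring))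
    (fun x hx => sc_cast ((hG (-x) hx).comp x (dn x)) (by ring))
    (fun a ha b hb => by
      have := heq (-a) ha (-b) hb
      rw [show (-a + -b)/2 = -((a+b)/2) by ring] at this
      linarith)
  rcases R with ⟨c₁, c₂, c₃, h0, h⟩ | ⟨⟨a, b, c, h⟩, ⟨a', b', c', h'⟩⟩ |
    ⟨μ, h0, ⟨a, b, c, h⟩, ⟨a', b', c', h'⟩⟩ | ⟨μ, h0, ⟨a, b, c, h⟩, ⟨a', b', c', h'⟩⟩
  · exact Or.inl ⟨c₁, c₂, c₃, h0, fun x hx => by simpa using h (-x) (hmem x hx)⟩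
  · refine Or.inr (Or.inl ⟨⟨a, -b, c, fun x hx => ?_⟩, ⟨a', -b', c', fun x hx => ?_⟩⟩)
    · simpa using h (-x) (hmem x hx)
    · simpa using h' (-x) (hmem x hx)
  · refine Or.inr (Or.inr (Or.inl ⟨-μ, by simpa using h0, ⟨a, b, c, fun x hx => ?_⟩, ⟨a', b', c', fun x hx => ?_⟩⟩))
    · simpa using h (-x) (hmem x hx)
    · simpa using h' (-x) (hmem x hx)
  · refine Or.inr (Or.inr (Or.inr ⟨-μ, by simpa using h0, ⟨a, b, c, fun x hx => ?_⟩, ⟨a', b', c', fun x hx => ?_⟩⟩))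
    · simpa using h (-x) (hmem x hx)
    · simpa using h' (-x) (hmem x hx)
end
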